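/- (Lemma 2.4, doubling with respect to the parameter.) Assume the Monge-Ampère measure μ of u is doubling with respect to the center of mass on the sections of u with constants α, β. Then there is a constant β' > 0 depending only on n, β, α such that for every x ∈ Ω and t > 0 with S_u(x, 2t) ⊂⊂ Ω, one has μ(S_u(x, 2t)) ≤ β' μ(S_u(x, t)). -/

import Mathlib

open MeasureTheory

noncomputable section

/-- Euclidean space `ℝⁿ`. -/
abbrev E (n : ℕ) := EuclideanSpace ℝ (Fin n)

/-- First partial derivative `∂_i f (x)`. -/
noncomputable def pd {n : ℕ} (f : E n → ℝ) (x : E n) (i : Fin n) : ℝ :=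
  fderiv ℝ f x (EuclideanSpace.single i 1)

/-- Second partial derivative `∂_{ij} f (x)`. -/
noncomputable def pd2 {n : ℕ} (f : E n → ℝ) (x : E n) (i j : Fin n) : ℝ :=
  fderiv ℝ (fun y => fderiv ℝ f y (EuclideanSpace.single j 1)) x (EuclideanSpace.single i 1)

/-- Hessian matrix `D²f(x)`. -/
noncomputable def Hess {n : ℕ} (f : E n → ℝ) (x : E n) : Matrix (Fin n) (Fin n) ℝ :=
  Matrix.of fun i j => pd2 f x i j

/-- The cofactor matrix `U = (det D²u)(D²u)⁻¹` of the Hessian of `u`,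
realized as the adjugate. -/
noncomputable def cofU {n : ℕ} (u : E n → ℝ) (x : E n) : Matrix (Fin n) (Fin n) ℝ :=
  (Hess u x).adjugate

/-- Section of the convex function `u`:
`S_u(x₀,t) = {x ∈ cl Ω : u x < u x₀ + ∇u(x₀)·(x - x₀) + t}`. -/
def MASection {n : ℕ} (Ω : Set (E n)) (u : E n → ℝ) (x₀ : E n) (t : ℝ) : Set (E n) :=
  {x ∈ closure Ω | u x < u x₀ + fderiv ℝ u x₀ (x - x₀) + t}

/-- `A ⊂⊂ B`: the closure of `A` is a compact subset of `B`. -/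
def CptIn {n : ℕ} (A B : Set (E n)) : Prop :=
  IsCompact (closure A) ∧ closure A ⊆ B

/-- Uniform convexity of a domain: balls of radius proportional to `‖x - y‖²`
centered at midpoints of points of the closure stay in the closure. -/
def UnifConvex {n : ℕ} (Ω : Set (E n)) : Prop :=
  ∃ δ > 0, ∀ x ∈ closure Ω, ∀ y ∈ closure Ω,
    Metric.closedBall (midpoint ℝ x y) (δ * ‖x - y‖ ^ 2) ⊆ closure Ω

/-- Standing assumptions: `Ω` is a bounded, open, nonempty, uniformly convex domain and
`u` is a smooth convex function on `cl Ω` vanishing on `∂Ω`. -/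
def MASetup {n : ℕ} (Ω : Set (E n)) (u : E n → ℝ) : Prop :=
  IsOpen Ω ∧ Bornology.IsBounded Ω ∧ Ω.Nonempty ∧ UnifConvex Ω ∧
  ContDiffOn ℝ (⊤ : ℕ∞) u (closure Ω) ∧ ConvexOn ℝ (closure Ω) u ∧
  ∀ x ∈ frontier Ω, u x = 0

/-- `λ ≤ det D²u ≤ Λ` in `Ω`. -/
def DetBounds {n : ℕ} (Ω : Set (E n)) (u : E n → ℝ) (lam Lam : ℝ) : Prop :=
  ∀ x ∈ Ω, lam ≤ (Hess u x).det ∧ (Hess u x).det ≤ Lam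

/-- The Monge-Ampère measure of `u`: `μ(A) = ∫_A det D²u`. -/
noncomputable def maMeasure {n : ℕ} (u : E n → ℝ) (A : Set (E n)) : ℝ :=
  ∫ x in A, (Hess u x).det

/-- Center of mass of a set. -/
noncomputable def centerOfMass {n : ℕ} (S : Set (E n)) : E n :=
  (volume S).toReal⁻¹ • ∫ x in S, x

/-- The `α`-dilation of `S` with respect to its center of mass. -/
def dilateCM {n : ℕ} (α : ℝ) (S : Set (E n)) : Set (E n) :=
  (fun x => centerOfMass S + α • (x - centerOfMass S)) '' S

/-- The Monge-Ampère measure of `u` is doubling with respect to the center of mass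
on the sections of `u`, with constants `0 < α < 1 < β`. -/
def DoublingCM {n : ℕ} (Ω : Set (E n)) (u : E n → ℝ) (α β : ℝ) : Prop :=
  0 < α ∧ α < 1 ∧ 1 < β ∧
  ∀ x₀ ∈ Ω, ∀ t : ℝ, 0 < t → CptIn (MASection Ω u x₀ t) Ω →
    maMeasure u (MASection Ω u x₀ t) ≤ β * maMeasure u (dilateCM α (MASection Ω u x₀ (t / 2)))

/-- `g` is a Green's function of the linearized Monge-Ampère operator `L_u` in `V`
with pole `y`: positive and smooth on `V \ {y}`, `L_u`-harmonic there, vanishing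
continuously on `∂V`, and `∫_V g · (L_u φ) = φ(y)` (i.e. `∫_V g · U^{ij}∂_{ij}φ = -φ(y)`)
for all test functions `φ`. -/
def IsGreen {n : ℕ} (u : E n → ℝ) (V : Set (E n)) (y : E n) (g : E n → ℝ) : Prop :=
  (∀ x ∈ V \ {y}, 0 < g x) ∧
  ContDiffOn ℝ (⊤ : ℕ∞) g (V \ {y}) ∧
  (∀ x ∈ V \ {y}, ∑ i, ∑ j, cofU u x i j * pd2 g x i j = 0) ∧
  ContinuousOn g (closure V \ {y}) ∧
  (∀ x ∈ frontier V, g x = 0) ∧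
  ∀ φ : E n → ℝ, ContDiff ℝ (⊤ : ℕ∞) φ → HasCompactSupport φ → tsupport φ ⊆ V →
    (∫ x in V, g x * ∑ i, ∑ j, cofU u x i j * pd2 φ x i j) = -φ y

/-- Capacity of a compact set `K` relative to `V` for the operator `L_u`:
the infimum of `∫_V U^{ij} ∂_iΦ ∂_jΦ` over Lipschitz `Φ` compactly supported in `V`
with `Φ ≥ 1` on `K`. -/
noncomputable def capacity {n : ℕ} (u : E n → ℝ) (K V : Set (E n)) : ℝ :=
  sInf { e : ℝ | ∃ Φ : E n → ℝ, (∃ L : NNReal, LipschitzWith L Φ) ∧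
    HasCompactSupport Φ ∧ tsupport Φ ⊆ V ∧ (∀ x ∈ K, 1 ≤ Φ x) ∧
    e = ∫ x in V, ∑ i, ∑ j, cofU u x i j * pd Φ x i * pd Φ x j }

/-- The entries of the Hessian matrix are the second Fréchet derivative on basis vectors. -/
theorem Hess_apply {n : ℕ} {u : E n → ℝ} {x : E n} (hu : ContDiffAt ℝ 2 u x) (i j : Fin n) :
    Hess u x i j =
      fderiv ℝ (fderiv ℝ u) x (EuclideanSpace.single i 1) (EuclideanSpace.single j 1) := by
  have hd : DifferentiableAt ℝ (fderiv ℝ u) x :=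
    (hu.fderiv_right (m := 1) (by norm_num)).differentiableAt (by norm_num)
  simp only [Hess, pd2, Matrix.of_apply]
  rw [fderiv_clm_apply hd (differentiableAt_const _)]
  simp

/-- The second derivative of a convex function is nonnegative. -/
theorem ConvexOn.fderiv_fderiv_nonneg {F : Type*} [NormedAddCommGroup F] [NormedSpace ℝ F]
    {s : Set F} {u : F → ℝ} (hc : ConvexOn ℝ s u) {x : F} (hs : s ∈ nhds x)
    (hu : ContDiffAt ℝ 2 u x) (v : F) : 0 ≤ fderiv ℝ (fderiv ℝ u) x v v := by
  have hd : DifferentiableAt ℝ (fderiv ℝ u) x :=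
    (hu.fderiv_right (m := 1) (by norm_num)).differentiableAt (by norm_num)
  have hev : ∀ᶠ y in nhds x, DifferentiableAt ℝ u y :=
    (hu.eventually (by simp)).mono fun y hy => hy.differentiableAt (by norm_num)
  obtain ⟨r, hr, hball⟩ := Metric.mem_nhds_iff.1 (Filter.inter_mem hs hev)
  let L : ℝ →ᵃ[ℝ] F := AffineMap.lineMap x (x + v)
  have hL : ∀ a, HasDerivAt L v a := fun a => by
    simpa using AffineMap.hasDerivAt_lineMap (a := x) (b := x + v) (x := a)
  have hL0 : L 0 = x := AffineMap.lineMap_apply_zero _ _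
  have hder : ∀ a ∈ L ⁻¹' Metric.ball x r, HasDerivAt (u ∘ L) (fderiv ℝ u (L a) v) a :=
    fun a ha => (hball ha).2.hasFDerivAt.comp_hasDerivAt a (hL a)
  have hmono : MonotoneOn (deriv (u ∘ L)) (L ⁻¹' Metric.ball x r) :=
    ((hc.subset (fun y hy => (hball hy).1) (convex_ball x r)).comp_affineMap L).monotoneOn_deriv
      fun a ha => (hder a ha).differentiableAt
  have hmem : L ⁻¹' Metric.ball x r ∈ nhds (0 : ℝ) :=
    (hL 0).continuousAt.preimage_mem_nhds (by rw [hL0]; exact Metric.ball_mem_nhds x hr)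
  have hdd : HasDerivAt (deriv (u ∘ L)) (fderiv ℝ (fderiv ℝ u) x v v) 0 := by
    have h1 : HasDerivAt (fun a => fderiv ℝ u (L a)) (fderiv ℝ (fderiv ℝ u) x v) 0 := by
      refine HasFDerivAt.comp_hasDerivAt (0 : ℝ) ?_ (hL 0)
      rw [hL0]
      exact hd.hasFDerivAt
    have h2 := h1.clm_apply (hasDerivAt_const (0 : ℝ) v)
    simp only [map_zero, add_zero] at h2
    refine h2.congr_of_eventuallyEq ?_
    filter_upwards [hmem] with a ha using (hder a ha).deriv
  rw [← hdd.deriv, ← derivWithin_of_mem_nhds hmem]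
  exact hmono.derivWithin_nonneg

/-- The Hessian determinant of a convex function is nonnegative. -/
theorem ConvexOn.det_Hess_nonneg {n : ℕ} {s : Set (E n)} {u : E n → ℝ} (hc : ConvexOn ℝ s u)
    {x : E n} (hs : s ∈ nhds x) (hu : ContDiffAt ℝ 2 u x) : 0 ≤ (Hess u x).det := by
  refine Matrix.PosSemidef.det_nonneg (Matrix.PosSemidef.of_dotProduct_mulVec_nonneg ?_ ?_)
  · ext i j
    simp only [Matrix.conjTranspose_apply, star_trivial, Hess_apply hu]
    exact (hu.isSymmSndFDerivAt (by simp)) _ _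
  · intro v
    have hv : WithLp.toLp 2 v = ∑ i, v i • (EuclideanSpace.single i (1 : ℝ) : E n) := by
      ext j
      simp [Finset.sum_apply, Pi.single_apply]
    have h := hc.fderiv_fderiv_nonneg hs hu (WithLp.toLp 2 v)
    rw [hv] at h
    simp only [map_sum, map_smul, sum_apply, smul_apply,
      smul_eq_mul, Finset.mul_sum] at h
    rw [Finset.sum_comm] at h
    simpa [dotProduct, Matrix.mulVec, Hess_apply hu, Finset.mul_sum, mul_comm, mul_left_comm]
      using h

/-- The Hessian determinant of a `C²` function is continuous. -/
theorem ContDiffAt.continuousAt_det_Hess {n : ℕ} {u : E n → ℝ} {x : E n}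
    (hu : ContDiffAt ℝ 2 u x) : ContinuousAt (fun y => (Hess u y).det) x := by
  refine ContinuousAt.comp (g := Matrix.det) (f := Hess u)
    (Continuous.matrix_det continuous_id).continuousAt ?_
  refine continuousAt_pi.2 fun i => continuousAt_pi.2 fun j => ?_
  have hc : ContinuousAt (fderiv ℝ (fderiv ℝ u)) x :=
    ((hu.fderiv_right (m := 1) (by norm_num)).fderiv_right (m := 0) (by norm_num)).continuousAt
  have h : ContinuousAt (fun y => fderiv ℝ (fderiv ℝ u) y (EuclideanSpace.single i 1)
      (EuclideanSpace.single j 1)) x := by fun_prop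
  refine h.congr ?_
  filter_upwards [hu.eventually (by simp)] with y hy using (Hess_apply hy i j).symm

/-- The center of mass of a nonempty bounded open convex set lies in its closure. -/
theorem centerOfMass_mem_closure {n : ℕ} {S : Set (E n)} (hc : Convex ℝ S) (ho : IsOpen S)
    (hb : Bornology.IsBounded S) (hne : S.Nonempty) : centerOfMass S ∈ closure S := by
  have hint : IntegrableOn (fun y : E n => y) S :=
    (continuous_id.continuousOn.integrableOn_compact hb.isCompact_closure).mono_set subset_closure
  have h := hc.closure.set_average_mem isClosed_closure (ho.measure_pos volume hne).ne'
    hb.measure_lt_top.ne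
    ((ae_restrict_iff' ho.measurableSet).2 (ae_of_all _ fun y hy => subset_closure hy)) hint
  rwa [setAverage_eq] at h

/-- Dilating a bounded open convex set about its center of mass by a factor in `(0, 1)` keeps it
inside itself. -/
theorem dilateCM_subset {n : ℕ} {S : Set (E n)} (hc : Convex ℝ S) (ho : IsOpen S)
    (hb : Bornology.IsBounded S) {α : ℝ} (h0 : 0 < α) (h1 : α < 1) : dilateCM α S ⊆ S := by
  rintro _ ⟨y, hy, rfl⟩
  have h := hc.combo_interior_closure_mem_interior (by rwa [ho.interior_eq])
    (centerOfMass_mem_closure hc ho hb ⟨y, hy⟩) h0 (sub_nonneg.2 h1.le) (by ring)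
  rw [ho.interior_eq] at h
  convert h using 1
  module

theorem MASection_mono {n : ℕ} (Ω : Set (E n)) (u : E n → ℝ) (x : E n) :
    Monotone (MASection Ω u x) :=
  fun _ _ h _ hy => ⟨hy.1, hy.2.trans_le (by linarith)⟩

theorem convex_MASection {n : ℕ} {Ω : Set (E n)} {u : E n → ℝ} (hc : ConvexOn ℝ (closure Ω) u)
    (x : E n) (t : ℝ) : Convex ℝ (MASection Ω u x t) := by
  intro y hy z hz a b ha hb hab
  refine ⟨hc.1 hy.1 hz.1 ha hb hab, ?_⟩
  have h := hc.2 hy.1 hz.1 ha hb hab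
  have h3 : fderiv ℝ u x (a • y + b • z - x) =
      a * fderiv ℝ u x (y - x) + b * fderiv ℝ u x (z - x) := by
    rw [← smul_eq_mul, ← smul_eq_mul, ← map_smul, ← map_smul, ← map_add]
    congr 1
    rw [show b = 1 - a by linarith]
    module
  simp only [smul_eq_mul] at h
  rw [h3]
  have hlt : a * u y + b * u z <
      a * (u x + fderiv ℝ u x (y - x) + t) + b * (u x + fderiv ℝ u x (z - x) + t) := by
    rcases ha.eq_or_lt with rfl | ha'
    · have : b = 1 := by linarith
      subst this
      simpa using hz.2
    · exact add_lt_add_of_lt_of_le (mul_lt_mul_of_pos_left hy.2 ha')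
        (mul_le_mul_of_nonneg_left hz.2.le hb)
  refine h.trans_lt (hlt.trans_eq ?_)
  rw [show b = 1 - a by linarith]
  ring

theorem isOpen_MASection {n : ℕ} {Ω : Set (E n)} {u : E n → ℝ} (ho : IsOpen Ω)
    (hu : ContinuousOn u Ω) {x : E n} {t : ℝ} (hS : MASection Ω u x t ⊆ Ω) :
    IsOpen (MASection Ω u x t) := by
  have h : MASection Ω u x t =
      Ω ∩ (fun y => u y - (u x + fderiv ℝ u x (y - x) + t)) ⁻¹' Set.Iio 0 := by
    ext y
    refine ⟨fun hy => ⟨hS hy, sub_neg.2 hy.2⟩, fun hy => ⟨subset_closure hy.1, sub_neg.1 hy.2⟩⟩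
  rw [h]
  exact ContinuousOn.isOpen_inter_preimage (by fun_prop) ho isOpen_Iio

/-- Lemma 2.4: the Monge-Ampère measure is doubling with respect to the parameter
on the sections of `u`. -/
theorem doubling_with_respect_to_parameter (n : ℕ) (hn : 2 ≤ n) (α β : ℝ) :
    ∃ β' > 0, ∀ (Ω : Set (E n)) (u : E n → ℝ),
      MASetup Ω u → DoublingCM Ω u α β →
      ∀ x ∈ Ω, ∀ t : ℝ, 0 < t → CptIn (MASection Ω u x (2 * t)) Ω →
        maMeasure u (MASection Ω u x (2 * t)) ≤ β' * maMeasure u (MASection Ω u x t) := by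
  refine ⟨max β 1, by positivity, ?_⟩
  rintro Ω u ⟨hΩ, hbd, -, -, hu, hc, -⟩ ⟨h0, h1, h1β, hdbl⟩ x hx t ht hcpt
  rw [max_eq_left h1β.le]
  have hnhds : ∀ y ∈ Ω, closure Ω ∈ nhds y := fun y hy =>
    Filter.mem_of_superset (hΩ.mem_nhds hy) subset_closure
  have hC2 : ∀ y ∈ Ω, ContDiffAt ℝ 2 u y := fun y hy =>
    (hu.contDiffAt (hnhds y hy)).of_le (WithTop.coe_le_coe.2 le_top)
  have hsub : closure (MASection Ω u x t) ⊆ Ω :=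
    (closure_mono (MASection_mono Ω u x (by linarith))).trans hcpt.2
  have hb : Bornology.IsBounded (MASection Ω u x t) := hbd.subset (subset_closure.trans hsub)
  have hopen : IsOpen (MASection Ω u x t) :=
    isOpen_MASection hΩ (hu.continuousOn.mono subset_closure) (subset_closure.trans hsub)
  have hint : IntegrableOn (fun y => (Hess u y).det) (MASection Ω u x t) :=
    (ContinuousOn.integrableOn_compact hb.isCompact_closure fun y hy =>
      (hC2 y (hsub hy)).continuousAt_det_Hess.continuousWithinAt).mono_set subset_closure
  have hnonneg : ∀ y ∈ MASection Ω u x t, 0 ≤ (Hess u y).det := fun y hy =>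
    hc.det_Hess_nonneg (hnhds y (hsub (subset_closure hy))) (hC2 y (hsub (subset_closure hy)))
  have h := hdbl x hx (2 * t) (by linarith) hcpt
  rw [mul_div_cancel_left₀ t two_ne_zero] at h
  refine h.trans (mul_le_mul_of_nonneg_left ?_ (by linarith))
  exact setIntegral_mono_set hint
    ((ae_restrict_iff' hopen.measurableSet).2 (ae_of_all _ hnonneg))
    (dilateCM_subset (convex_MASection hc x t) hopen hb h0 h1).eventuallyLE
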